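/- Let k, K > 0 and let T_max be a positive integer. Consider the feasible set D = {(T, σ, q) : T ∈ {1, …, T_max}, σ > 0, 0 < q ≤ 1} with objectives f₁(T, σ, q) = 1/T + k·σ²/(q·K) and f₂(T, σ, q) = √(q·T)/σ. Then every point (T, σ, q) ∈ D satisfying k·σ²·T = q·K is Pareto optimal on D. -/

import Mathlib

/-- Pareto optimality of a point `x` of a feasible set `D` for objectives `(f₁, f₂)`:
`x ∈ D` and no `y ∈ D` Pareto-dominates `x`. -/
def ParetoOptimal {α : Type*} (D : Set α) (f₁ f₂ : α → ℝ) (x : α) : Prop :=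
  x ∈ D ∧ ¬ ∃ y ∈ D, (f₁ y ≤ f₁ x ∧ f₂ y ≤ f₂ x) ∧ (f₁ y < f₁ x ∨ f₂ y < f₂ x)

lemma aux_prod (k K : ℝ) (hK : 0 < K) (T s q : ℝ) (hT : 0 < T) (hs : 0 < s)
    (hq : 0 < q) :
    (1 / T) * (k * s ^ 2 / (q * K)) * (Real.sqrt (q * T) / s) ^ 2 = k / K := by
  rw [div_pow, Real.sq_sqrt (by positivity)]
  field_simp

lemma aux_main (a b g a' b' g' c : ℝ) (ha : 0 < a) (ha' : 0 < a') (hb' : 0 < b')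
    (hg : 0 < g) (hg' : 0 < g') (hab : a = b) (h : a * b * g ^ 2 = c)
    (h' : a' * b' * g' ^ 2 = c) (h1 : a' + b' ≤ a + b) (h2 : g' ≤ g)
    (h3 : a' + b' < a + b ∨ g' < g) : False := by
  subst hab
  have hs : a' * b' * 4 ≤ (a' + b') ^ 2 := by nlinarith [sq_nonneg (a' - b')]
  have e : a * a * g ^ 2 = a' * b' * g' ^ 2 := by rw [h, h']
  rcases h3 with h3 | h3
  · have h4 : a' * b' < a * a := by nlinarith
    have h5 : g' ^ 2 ≤ g ^ 2 := by gcongr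
    have : a' * b' * g' ^ 2 < a * a * g ^ 2 :=
      mul_lt_mul h4 h5 (by positivity) (by positivity)
    linarith
  · have h4 : a' * b' ≤ a * a := by nlinarith
    have h5 : g' ^ 2 < g ^ 2 := by gcongr
    have : a' * b' * g' ^ 2 < a * a * g ^ 2 :=
      mul_lt_mul' h4 h5 (by positivity) (by positivity)
    linarith

theorem stmt_4 (k K : ℝ) (hk : 0 < k) (hK : 0 < K) (Tmax : ℕ) (hTmax : 0 < Tmax)
    (D : Set (ℕ × ℝ × ℝ))
    (hD : D = {p : ℕ × ℝ × ℝ |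
      1 ≤ p.1 ∧ p.1 ≤ Tmax ∧ 0 < p.2.1 ∧ 0 < p.2.2 ∧ p.2.2 ≤ 1})
    (f₁ f₂ : ℕ × ℝ × ℝ → ℝ)
    (hf₁ : f₁ = fun p => 1 / (p.1 : ℝ) + k * p.2.1 ^ 2 / (p.2.2 * K))
    (hf₂ : f₂ = fun p => Real.sqrt (p.2.2 * (p.1 : ℝ)) / p.2.1) :
    ∀ p ∈ D, k * p.2.1 ^ 2 * (p.1 : ℝ) = p.2.2 * K → ParetoOptimal D f₁ f₂ p := by
  subst hD hf₁ hf₂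
  rintro ⟨T, s, q⟩ hp he
  refine ⟨hp, ?_⟩
  rintro ⟨⟨T', s', q'⟩, hp', ⟨h1, h2⟩, h3⟩
  obtain ⟨hT, -, hs, hq, -⟩ := hp
  obtain ⟨hT', -, hs', hq', -⟩ := hp'
  dsimp only at *
  have pT : (0 : ℝ) < T := by exact_mod_cast hT
  have pT' : (0 : ℝ) < T' := by exact_mod_cast hT'
  refine aux_main _ _ _ _ _ _ (k / K) ?_ ?_ ?_ ?_ ?_ ?_
    (aux_prod k K hK T s q pT hs hq) (aux_prod k K hK T' s' q' pT' hs' hq') h1 h2 h3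
  any_goals positivity
  rw [div_eq_div_iff (by positivity) (by positivity)]
  linarith
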